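/- For every dimension d ≥ 4 there exists a tiling of d-dimensional Euclidean space by convex polytopes that is not face-to-face, is monocoronal up to rigid motions, and is non-periodic: the only vector v such that translation by v is a symmetry of the tiling is v = 0. -/

import Mathlib

noncomputable section

open Set

abbrev Ed (d : ℕ) := EuclideanSpace ℝ (Fin d)

variable (d : ℕ)

/-- A convex polytope: a compact convex subset with nonempty interior and finitely
many extreme points. -/
def IsConvexPolytope (P : Set (Ed d)) : Prop :=
  IsCompact P ∧ Convex ℝ P ∧ (interior P).Nonempty ∧ (Set.extremePoints ℝ P).Finite

/-- A tiling of `ℝ^d` by convex polytopes. -/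
def IsTiling (T : Set (Set (Ed d))) : Prop :=
  T.Countable ∧ (∀ P ∈ T, IsConvexPolytope d P) ∧ (⋃₀ T = Set.univ) ∧
    T.Pairwise fun P Q => Disjoint (interior P) (interior Q)

/-- A vertex of a tiling: an extreme point of at least one tile. -/
def IsVertex (T : Set (Set (Ed d))) (x : Ed d) : Prop :=
  ∃ P ∈ T, x ∈ Set.extremePoints ℝ P

/-- An isometry is orientation preserving if its linear part has determinant `1`. -/
def OrientationPreserving (f : Ed d ≃ᵃⁱ[ℝ] Ed d) : Prop :=
  LinearMap.det (f.linearIsometryEquiv.toLinearEquiv : Ed d →ₗ[ℝ] Ed d) = 1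

/-- Monocoronal up to congruence: any two vertex coronae are congruent. -/
def MonocoronalC (T : Set (Set (Ed d))) : Prop :=
  ∀ x y : Ed d, IsVertex d T x → IsVertex d T y →
    ∃ f : Ed d ≃ᵃⁱ[ℝ] Ed d, f x = y ∧
      (fun P => f '' P) '' {P | P ∈ T ∧ x ∈ P} = {P | P ∈ T ∧ y ∈ P}

/-- Monocoronal up to rigid motions: any two vertex coronae are directly congruent. -/
def MonocoronalRM (T : Set (Set (Ed d))) : Prop :=
  ∀ x y : Ed d, IsVertex d T x → IsVertex d T y →
    ∃ f : Ed d ≃ᵃⁱ[ℝ] Ed d, OrientationPreserving d f ∧ f x = y ∧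
      (fun P => f '' P) '' {P | P ∈ T ∧ x ∈ P} = {P | P ∈ T ∧ y ∈ P}

/-- A tiling is face-to-face if the intersection of any two distinct tiles is an
extreme subset of each of them. -/
def FaceToFace (T : Set (Set (Ed d))) : Prop :=
  ∀ P ∈ T, ∀ Q ∈ T, P ≠ Q → IsExtreme ℝ P (P ∩ Q) ∧ IsExtreme ℝ Q (P ∩ Q)

/-- A symmetry of a tiling: an isometry mapping the set of tiles onto itself. -/
def IsSymmetry (T : Set (Set (Ed d))) (f : Ed d ≃ᵃⁱ[ℝ] Ed d) : Prop :=
  (fun P => f '' P) '' T = T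

/-- The set of translation vectors of a tiling. -/
def periodVectors (T : Set (Set (Ed d))) : Set (Ed d) :=
  {v | IsSymmetry d T (AffineIsometryEquiv.constVAdd ℝ (Ed d) v)}

section Construction

/-- Data choosing coordinate axes. `u` is the layer axis; in the layer with index `n`, the axis
`w n` is the stacking axis, and bricks are laid along `x n` with rows indexed by `y n`. -/
structure AxisData (d : ℕ) where
  u : Fin d
  w : ℤ → Fin d
  x : ℤ → Fin d
  y : ℤ → Fin d
  uw : ∀ n, u ≠ w n
  ux : ∀ n, u ≠ x n
  uy : ∀ n, u ≠ y n
  wx : ∀ n, w n ≠ x n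
  wy : ∀ n, w n ≠ y n
  xy : ∀ n, x n ≠ y n
  surj : ∀ i, i ≠ u → ∃ n, 0 ≤ n ∧ Odd n ∧ w n = i

theorem exists_axisData {d : ℕ} (hd : 4 ≤ d) : Nonempty (AxisData d) := by
  classical
  let u : Fin d := ⟨0, by omega⟩
  let w : ℤ → Fin d := fun n =>
    if h : n.toNat / 2 < d ∧ n.toNat / 2 ≠ 0 then ⟨n.toNat / 2, h.1⟩ else ⟨1, by omega⟩
  have hw : ∀ n, u ≠ w n := by
    intro n h
    have := congrArg Fin.val h
    simp only [u, w] at this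
    split_ifs at this with h1
    exact h1.2 this.symm
  have key : ∀ i : Fin d, ∃ x y : Fin d, u ≠ x ∧ u ≠ y ∧ i ≠ x ∧ i ≠ y ∧ x ≠ y := by
    intro i
    have h1 : ({u, i} : Finset (Fin d)).card < (Finset.univ : Finset (Fin d)).card := by
      have := Finset.card_le_two (a := u) (b := i)
      simp only [Finset.card_univ, Fintype.card_fin]; omega
    obtain ⟨x, -, hx⟩ := Finset.exists_mem_notMem_of_card_lt_card h1
    have h2 : ({u, i, x} : Finset (Fin d)).card < (Finset.univ : Finset (Fin d)).card := by
      have := Finset.card_le_three (a := u) (b := i) (c := x)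
      simp only [Finset.card_univ, Fintype.card_fin]; omega
    obtain ⟨y, -, hy⟩ := Finset.exists_mem_notMem_of_card_lt_card h2
    simp only [Finset.mem_insert, Finset.mem_singleton, not_or] at hx hy
    exact ⟨x, y, Ne.symm hx.1, Ne.symm hy.1, Ne.symm hx.2, Ne.symm hy.2.1, Ne.symm hy.2.2⟩
  choose X Y h using key
  refine ⟨⟨u, w, fun n => X (w n), fun n => Y (w n), hw, fun n => (h _).1, fun n => (h _).2.1,
    fun n => (h _).2.2.1, fun n => (h _).2.2.2.1, fun n => (h _).2.2.2.2, ?_⟩⟩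
  intro i hi
  refine ⟨2 * (i : ℕ) + 1, by positivity, ⟨i, rfl⟩, ?_⟩
  have e : (2 * ((i : ℕ) : ℤ) + 1).toNat / 2 = i := by omega
  have hi0 : (i : ℕ) ≠ 0 := fun h0 => hi (Fin.ext h0)
  simp only [w, e]
  rw [dif_pos ⟨i.2, hi0⟩]

variable {d : ℕ} (D : AxisData d)

/-- The phase bits. -/
def bit (n k : ℤ) : ℤ := if 0 ≤ n ∧ 0 ≤ k then 1 else 0

/-- Cells that belong to dominoes. -/
def dom (c : Fin d → ℤ) : Prop := Odd (c D.u) ∧ Odd (c (D.w (c D.u)))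

/-- The parity of the phase decides whether a domino cell is the first or the second one. -/
def ph (c : Fin d → ℤ) : ℤ :=
  c (D.x (c D.u)) + c (D.y (c D.u)) + bit (c D.u) (c (D.w (c D.u)))

open Classical in
def lo (c : Fin d → ℤ) (i : Fin d) : ℤ :=
  if dom D c ∧ Odd (ph D c) ∧ i = D.x (c D.u) then c i - 1 else c i

open Classical in
def hi (c : Fin d → ℤ) (i : Fin d) : ℤ :=
  if dom D c ∧ Even (ph D c) ∧ i = D.x (c D.u) then c i + 2 else c i + 1

/-- Axis-parallel boxes with integer corners. -/
def box (a b : Fin d → ℤ) : Set (Ed d) := {z | ∀ i, (a i : ℝ) ≤ z i ∧ z i ≤ (b i : ℝ)}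

def tile (c : Fin d → ℤ) : Set (Ed d) := box (lo D c) (hi D c)

def tiles : Set (Set (Ed d)) := Set.range (tile D)

theorem lo_le (c : Fin d → ℤ) (i : Fin d) : lo D c i ≤ c i := by
  unfold lo; split_ifs <;> omega

theorem lt_hi (c : Fin d → ℤ) (i : Fin d) : c i + 1 ≤ hi D c i := by
  unfold hi; split_ifs <;> omega

theorem lo_of_ne (c : Fin d → ℤ) (i : Fin d) (h : i ≠ D.x (c D.u)) : lo D c i = c i := by
  simp [lo, h]

theorem hi_of_ne (c : Fin d → ℤ) (i : Fin d) (h : i ≠ D.x (c D.u)) : hi D c i = c i + 1 := by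
  simp [hi, h]

theorem lo_not_dom (c : Fin d → ℤ) (h : ¬ dom D c) : lo D c = c := by
  funext i; simp [lo, h]

theorem hi_not_dom (c : Fin d → ℤ) (h : ¬ dom D c) (i : Fin d) : hi D c i = c i + 1 := by
  simp [hi, h]

theorem lo_x (c : Fin d → ℤ) (h : dom D c) :
    lo D c (D.x (c D.u)) = if Odd (ph D c) then c (D.x (c D.u)) - 1 else c (D.x (c D.u)) := by
  classical
  simp [lo, h]

theorem hi_x (c : Fin d → ℤ) (h : dom D c) :
    hi D c (D.x (c D.u)) = if Odd (ph D c) then c (D.x (c D.u)) + 1 else c (D.x (c D.u)) + 2 := by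
  classical
  by_cases h' : Odd (ph D c)
  · have : ¬ Even (ph D c) := Int.not_even_iff_odd.2 h'
    simp [hi, h']
  · have : Even (ph D c) := Int.not_odd_iff_even.1 h'
    simp [hi, h, this]

/-- A unit cell lying in a tile generates the same tile. -/
theorem cell_mem {c m : Fin d → ℤ} (h : ∀ i, lo D c i ≤ m i ∧ m i < hi D c i) :
    lo D m = lo D c ∧ hi D m = hi D c := by
  have hne : ∀ i, i ≠ D.x (c D.u) → m i = c i := by
    intro i hi'
    have := h i
    rw [lo_of_ne D c i hi', hi_of_ne D c i hi'] at this
    omega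
  by_cases hm : m (D.x (c D.u)) = c (D.x (c D.u))
  · have : m = c := by
      funext i
      by_cases hi' : i = D.x (c D.u)
      · rw [hi', hm]
      · exact hne i hi'
    rw [this]; exact ⟨rfl, rfl⟩
  have hdc : dom D c := by
    by_contra hd
    have := h (D.x (c D.u))
    rw [lo_not_dom D c hd, hi_not_dom D c hd] at this
    omega
  have hu := hne D.u (D.ux _)
  have hw := hne _ (D.wx (c D.u))
  have hy := hne _ (D.xy (c D.u)).symm
  have hdm : dom D m := by
    unfold dom at *; rw [hu, hw]; exact hdc
  have hph : ph D m = ph D c + (m (D.x (c D.u)) - c (D.x (c D.u))) := by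
    unfold ph; rw [hu, hw, hy]; ring
  have hx := h (D.x (c D.u))
  have l1 := lo_x D m hdm
  have l2 := hi_x D m hdm
  rw [hu] at l1 l2
  rw [lo_x D c hdc, hi_x D c hdc] at hx
  have hxx : lo D m (D.x (c D.u)) = lo D c (D.x (c D.u)) ∧
      hi D m (D.x (c D.u)) = hi D c (D.x (c D.u)) := by
    rw [l1, l2, lo_x D c hdc, hi_x D c hdc]
    by_cases ho : Odd (ph D c)
    · simp only [ho, if_true] at hx ⊢
      have e : m (D.x (c D.u)) = c (D.x (c D.u)) - 1 := by omega
      have : ¬ Odd (ph D m) := by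
        rw [hph, e]; rw [Int.odd_iff] at *; omega
      simp only [this, if_false]; omega
    · simp only [ho, if_false] at hx ⊢
      have e : m (D.x (c D.u)) = c (D.x (c D.u)) + 1 := by omega
      have : Odd (ph D m) := by
        rw [hph, e]; rw [Int.odd_iff] at *; omega
      simp only [this, if_true]; omega
  constructor
  · funext i
    by_cases hi' : i = D.x (c D.u)
    · rw [hi']; exact hxx.1
    · rw [lo_of_ne D c i hi', lo_of_ne D m i (by rw [hu]; exact hi'), hne i hi']
  · funext i
    by_cases hi' : i = D.x (c D.u)
    · rw [hi']; exact hxx.2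
    · rw [hi_of_ne D c i hi', hi_of_ne D m i (by rw [hu]; exact hi'), hne i hi']

theorem tile_eq_of_cell_mem {c m : Fin d → ℤ} (h : ∀ i, lo D c i ≤ m i ∧ m i < hi D c i) :
    tile D m = tile D c := by
  obtain ⟨h1, h2⟩ := cell_mem D h
  unfold tile; rw [h1, h2]

/-- Convert an integer vector to a point. -/
def pt (p : Fin d → ℤ) : Ed d := WithLp.toLp 2 fun i => (p i : ℝ)

@[simp] theorem pt_apply (p : Fin d → ℤ) (i : Fin d) : pt p i = (p i : ℝ) := rfl

theorem isCompact_box (a b : Fin d → ℤ) : IsCompact (box a b) := by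
  have h : IsCompact (Set.univ.pi fun i => Set.Icc (a i : ℝ) (b i : ℝ)) :=
    isCompact_univ_pi fun i => isCompact_Icc
  have h2 := h.image (PiLp.continuous_toLp 2 fun _ : Fin d => ℝ)
  convert h2 using 1
  ext z
  constructor
  · intro hz
    exact ⟨WithLp.ofLp z, fun i _ => hz i, rfl⟩
  · rintro ⟨f, hf, rfl⟩ i
    exact hf i trivial

theorem convex_box (a b : Fin d → ℤ) : Convex ℝ (box a b) := by
  intro z hz z' hz' s t hs ht hst i
  have h1 := hz i
  have h2 := hz' i
  simp only [PiLp.add_apply, PiLp.smul_apply, smul_eq_mul]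
  have e1 : (a i : ℝ) = s * a i + t * a i := by rw [← add_mul, hst, one_mul]
  have e2 : (b i : ℝ) = s * b i + t * b i := by rw [← add_mul, hst, one_mul]
  constructor
  · rw [e1]; gcongr <;> tauto
  · rw [e2]; gcongr <;> tauto

theorem interior_box_subset (a b : Fin d → ℤ) {z : Ed d} (hz : z ∈ interior (box a b)) (i : Fin d) :
    (a i : ℝ) < z i ∧ z i < (b i : ℝ) := by
  have hop : IsOpenMap (fun z : Ed d => z i) := by
    have h1 : IsOpenMap (fun f : Fin d → ℝ => f i) := isOpenMap_eval i
    exact h1.comp (PiLp.homeomorph 2 fun _ : Fin d => ℝ).isOpenMap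
  have hcont : Continuous (fun z : Ed d => z i) := by fun_prop
  have hsub : box a b ⊆ (fun z : Ed d => z i) ⁻¹' Set.Icc (a i : ℝ) (b i) := fun z hz => hz i
  have := interior_mono hsub hz
  rw [← hop.preimage_interior_eq_interior_preimage hcont, interior_Icc] at this
  exact this

theorem subset_interior_box (a b : Fin d → ℤ) {z : Ed d}
    (hz : ∀ i, (a i : ℝ) < z i ∧ z i < (b i : ℝ)) : z ∈ interior (box a b) := by
  have hopen : IsOpen {z : Ed d | ∀ i, (a i : ℝ) < z i ∧ z i < (b i : ℝ)} := by
    have : {z : Ed d | ∀ i, (a i : ℝ) < z i ∧ z i < (b i : ℝ)} =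
        ⋂ i, {z : Ed d | (a i : ℝ) < z i ∧ z i < (b i : ℝ)} := by
      ext z; simp
    rw [this]
    refine isOpen_iInter_of_finite fun i => ?_
    have hcont : Continuous (fun z : Ed d => z i) := by fun_prop
    exact (isOpen_Ioo (a := (a i : ℝ)) (b := (b i : ℝ))).preimage hcont
  exact interior_maximal (fun z hz i => ⟨(hz i).1.le, (hz i).2.le⟩) hopen hz

theorem extreme_box (a b : Fin d → ℤ) {z : Ed d} (hz : z ∈ Set.extremePoints ℝ (box a b))
    (i : Fin d) : z i = a i ∨ z i = b i := by
  classical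
  by_contra hcon
  push Not at hcon
  obtain ⟨hzb, hext⟩ := hz
  have hi := hzb i
  have h1 : (a i : ℝ) < z i := lt_of_le_of_ne hi.1 (Ne.symm hcon.1)
  have h2 : z i < b i := lt_of_le_of_ne hi.2 hcon.2
  obtain ⟨ε, hε, he1, he2⟩ : ∃ ε : ℝ, 0 < ε ∧ (a i : ℝ) ≤ z i - ε ∧ z i + ε ≤ b i := by
    refine ⟨min (z i - a i) (b i - z i), lt_min (by linarith) (by linarith), ?_, ?_⟩
    · have := min_le_left (z i - a i) (b i - z i); linarith
    · have := min_le_right (z i - a i) (b i - z i); linarith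
  have m1 : z - EuclideanSpace.single i ε ∈ box a b := by
    intro j
    by_cases hj : j = i
    · subst hj; simp; constructor <;> linarith
    · simpa [hj] using hzb j
  have m2 : z + EuclideanSpace.single i ε ∈ box a b := by
    intro j
    by_cases hj : j = i
    · subst hj; simp; constructor <;> linarith
    · simpa [hj] using hzb j
  have hseg : z ∈ openSegment ℝ (z - EuclideanSpace.single i ε) (z + EuclideanSpace.single i ε) := by
    refine ⟨1/2, 1/2, by norm_num, by norm_num, by norm_num, ?_⟩
    module
  have := hext m1 m2 hseg
  have h3 := congrArg (fun v : Ed d => v i) this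
  simp at h3
  linarith

theorem isConvexPolytope_box (a b : Fin d → ℤ) (h : ∀ i, a i < b i) :
    IsConvexPolytope d (box a b) := by
  refine ⟨isCompact_box a b, convex_box a b, ?_, ?_⟩
  · refine ⟨WithLp.toLp 2 fun i => ((a i : ℝ) + b i) / 2, subset_interior_box a b fun i => ?_⟩
    have : (a i : ℝ) < b i := by exact_mod_cast h i
    simp only
    constructor <;> linarith
  · have hf : (Set.univ.pi fun i => ({(a i : ℝ), (b i : ℝ)} : Set ℝ)).Finite :=
      Set.Finite.pi' (fun i => by simp) |>.subset (fun f hf i => hf i trivial)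
    refine (hf.image (WithLp.toLp 2)).subset ?_
    intro z hz
    exact ⟨WithLp.ofLp z, fun i _ => by simpa using extreme_box a b hz i, rfl⟩

theorem box_subset_imp {a b a' b' : Fin d → ℤ} {v : Ed d} (hab : ∀ i, a i ≤ b i)
    (h : ∀ z, z ∈ box a b ↔ v + z ∈ box a' b') (hab' : ∀ i, a' i ≤ b' i) (i : Fin d) :
    (a' i : ℝ) = v i + a i ∧ (b' i : ℝ) = v i + b i := by
  have m1 : pt a ∈ box a b := fun i => ⟨le_rfl, by simpa using hab i⟩
  have m2 : pt b ∈ box a b := fun i => ⟨by simpa using hab i, le_rfl⟩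
  have m3 : pt a' - v ∈ box a b := by
    rw [h]; intro i; simpa using hab' i
  have m4 : pt b' - v ∈ box a b := by
    rw [h]; intro i; simpa using hab' i
  have h1 := ((h _).1 m1) i
  have h2 := ((h _).1 m2) i
  have h3 := m3 i
  have h4 := m4 i
  simp at h1 h2 h3 h4
  constructor <;> linarith

theorem lo_lt_hi (c : Fin d → ℤ) (i : Fin d) : lo D c i < hi D c i := by
  have := lo_le D c i
  have := lt_hi D c i
  omega

theorem isTiling_tiles : IsTiling d (tiles D) := by
  refine ⟨Set.countable_range _, ?_, ?_, ?_⟩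
  · rintro _ ⟨c, rfl⟩
    exact isConvexPolytope_box _ _ (lo_lt_hi D c)
  · refine Set.eq_univ_of_forall fun z => ?_
    refine ⟨tile D (fun i => ⌊z i⌋), ⟨_, rfl⟩, fun i => ?_⟩
    have h1 : (lo D (fun i => ⌊z i⌋) i : ℝ) ≤ ⌊z i⌋ := by exact_mod_cast lo_le D _ i
    have h2 : (⌊z i⌋ : ℝ) + 1 ≤ hi D (fun i => ⌊z i⌋) i := by
      exact_mod_cast lt_hi D (fun i => ⌊z i⌋) i
    have h3 := Int.floor_le (z i)
    have h4 := Int.lt_floor_add_one (z i)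
    constructor <;> linarith
  · rintro _ ⟨c, rfl⟩ _ ⟨c', rfl⟩ hne
    rw [Set.disjoint_left]
    intro z hz hz'
    apply hne
    have h1 := interior_box_subset _ _ hz
    have h2 := interior_box_subset _ _ hz'
    have h3 : ∀ i, lo D c i < hi D c' i := fun i => by
      exact_mod_cast (h1 i).1.trans (h2 i).2
    have h4 : ∀ i, lo D c' i < hi D c i := fun i => by
      exact_mod_cast (h2 i).1.trans (h1 i).2
    have e1 := tile_eq_of_cell_mem D (c := c) (m := fun i => max (lo D c i) (lo D c' i))
      fun i => ⟨le_max_left _ _, max_lt (lo_lt_hi D c i) (h4 i)⟩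
    have e2 := tile_eq_of_cell_mem D (c := c') (m := fun i => max (lo D c i) (lo D c' i))
      fun i => ⟨le_max_right _ _, max_lt (h3 i) (lo_lt_hi D c' i)⟩
    rw [← e1, e2]

theorem exists_dom (n k : ℤ) (hn : Odd n) (hk : Odd k) (f : Fin d → ℤ) :
    ∃ c : Fin d → ℤ, c D.u = n ∧ c (D.w n) = k ∧ (∀ i, i ≠ D.u → i ≠ D.w n → c i = f i) ∧
      dom D c := by
  classical
  refine ⟨fun i => if i = D.u then n else if i = D.w n then k else f i, by simp, ?_, ?_, ?_⟩
  · simp [(D.uw n).symm]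
  · intro i h1 h2; simp [h1, h2]
  · simp [dom, (D.uw n).symm, hn, hk]

theorem not_faceToFace : ¬ FaceToFace d (tiles D) := by
  classical
  intro hF
  obtain ⟨c, hu, hw, hf, hdc⟩ := exists_dom D 1 1 odd_one odd_one
    (fun i => if i = D.x 1 then 1 else 0)
  have hx : c (D.x 1) = 1 := by
    rw [hf _ (D.ux 1).symm (D.wx 1).symm]; simp
  have hy : c (D.y 1) = 0 := by
    rw [hf _ (D.uy 1).symm (D.wy 1).symm]; simp [(D.xy 1).symm]
  have hph : ph D c = 2 := by simp [ph, hu, hw, hx, hy, bit]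
  let c' : Fin d → ℤ := Function.update c (D.y 1) (-1)
  have hu' : c' D.u = 1 := by simp [c', D.uy 1, hu]
  have hw' : c' (D.w 1) = 1 := by simp [c', D.wy 1, hw]
  have hx' : c' (D.x 1) = 1 := by simp [c', D.xy 1, hx]
  have hy' : c' (D.y 1) = -1 := by simp [c']
  have hph' : ph D c' = 1 := by simp [ph, hu', hw', hx', hy', bit]
  have hdc' : dom D c' := by simp [dom, hu', hw']
  have ho : ¬ Odd (ph D c) := by rw [hph]; decide
  have ho' : Odd (ph D c') := by rw [hph']; decide
  have l1 := lo_x D c hdc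
  have l2 := hi_x D c hdc
  have l1' := lo_x D c' hdc'
  have l2' := hi_x D c' hdc'
  simp only [ho, ho', if_true, if_false, hu, hu', hx, hx'] at l1 l2 l1' l2'
  have key : ∀ t : ℤ, -1 ≤ t → t ≤ 1 → pt (Function.update c (D.x 1) (1 + t)) ∈ tile D c' := by
    intro t ht1 ht2 i
    simp only [pt_apply]
    norm_cast
    by_cases hi1 : i = D.x 1
    · subst hi1
      rw [l1', l2', Function.update_self]; omega
    · rw [lo_of_ne D c' i (by rwa [hu']), hi_of_ne D c' i (by rwa [hu']),
        Function.update_of_ne hi1]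
      by_cases hi2 : i = D.y 1
      · subst hi2; rw [hy', hy]; omega
      · simp [c', Function.update_of_ne hi2]
  have m0 : pt c ∈ tile D c := by
    intro i
    simp only [pt_apply]
    have := lo_le D c i
    have := lt_hi D c i
    norm_cast
    omega
  have e0 : Function.update c (D.x 1) (1 + 0) = c := by
    have h : (1 + 0 : ℤ) = c (D.x 1) := by rw [hx]; rfl
    rw [h, Function.update_eq_self]
  have m0' : pt c ∈ tile D c' := by
    have := key 0 (by norm_num) (by norm_num)
    rwa [e0] at this
  have mm : pt (Function.update c (D.x 1) (1 + (-1))) ∉ tile D c := by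
    intro h
    have := (h (D.x 1)).1
    rw [l1] at this
    norm_num at this
  have hne : tile D c' ≠ tile D c := by
    intro h
    exact mm (h ▸ key (-1) (by norm_num) (by norm_num))
  have hext := (hF _ ⟨c', rfl⟩ _ ⟨c, rfl⟩ hne).1
  refine mm (hext.left_mem_of_mem_openSegment (key (-1) (by norm_num) (by norm_num))
    (key 1 (by norm_num) (by norm_num)) ⟨m0', m0⟩ ?_).2
  refine ⟨1/2, 1/2, by norm_num, by norm_num, by norm_num, ?_⟩
  ext i
  simp only [PiLp.add_apply, PiLp.smul_apply, smul_eq_mul, pt_apply]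
  by_cases hi1 : i = D.x 1
  · subst hi1; simp [hx]
  · simp [Function.update_of_ne hi1]; ring

theorem period_int {v : Ed d} (hv : v ∈ periodVectors d (tiles D)) :
    ∃ V : Fin d → ℤ, v = pt V ∧
      ∀ c : Fin d → ℤ, lo D (c + V) = lo D c + V ∧ hi D (c + V) = hi D c + V := by
  have h0 : ∀ c : Fin d → ℤ, ∃ c' : Fin d → ℤ, ∀ i,
      (lo D c' i : ℝ) = v i + lo D c i ∧ (hi D c' i : ℝ) = v i + hi D c i := by
    intro c
    have hm : (fun P => (AffineIsometryEquiv.constVAdd ℝ (Ed d) v) '' P) (tile D c) ∈ tiles D := by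
      have hv' : IsSymmetry d (tiles D) (AffineIsometryEquiv.constVAdd ℝ (Ed d) v) := hv
      unfold IsSymmetry at hv'
      rw [← hv']
      exact Set.mem_image_of_mem _ ⟨c, rfl⟩
    obtain ⟨c', hc'⟩ := hm
    refine ⟨c', box_subset_imp (fun i => (lo_lt_hi D c i).le) (fun z => ?_)
      (fun i => (lo_lt_hi D c' i).le)⟩
    change z ∈ tile D c ↔ v + z ∈ tile D c'
    rw [hc']
    constructor
    · intro hz
      exact ⟨z, hz, by simp⟩
    · rintro ⟨z', hz', h⟩
      have : z' = z := by simpa using h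
      rwa [← this]
  obtain ⟨c1, hc1⟩ := h0 0
  refine ⟨fun i => lo D c1 i - lo D 0 i, ?_, ?_⟩
  · ext i
    have := (hc1 i).1
    simp only [pt_apply]; push_cast; linarith
  · intro c
    obtain ⟨c', hc'⟩ := h0 c
    have e : ∀ i, lo D c' i = lo D c i + (lo D c1 i - lo D 0 i) ∧
        hi D c' i = hi D c i + (lo D c1 i - lo D 0 i) := by
      intro i
      have h1 := (hc1 i).1
      have h2 := hc' i
      constructor
      · have : (lo D c' i : ℝ) = lo D c i + (lo D c1 i - lo D 0 i) := by linarith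
        exact_mod_cast this
      · have : (hi D c' i : ℝ) = hi D c i + (lo D c1 i - lo D 0 i) := by linarith
        exact_mod_cast this
    have := cell_mem D (c := c') (m := c + fun i => lo D c1 i - lo D 0 i) (fun i => by
      have h1 := lo_le D c i
      have h2 := lt_hi D c i
      have h3 := e i
      simp only [Pi.add_apply]
      omega)
    rw [this.1, this.2]
    exact ⟨funext fun i => (e i).1, funext fun i => (e i).2⟩

theorem dom_iff (c : Fin d → ℤ) : dom D c ↔ ∃ i, hi D c i ≠ lo D c i + 1 := by
  constructor
  · intro h
    refine ⟨D.x (c D.u), ?_⟩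
    rw [lo_x D c h, hi_x D c h]
    split_ifs <;> omega
  · rintro ⟨i, hi'⟩
    by_contra h
    rw [hi_not_dom D c h, lo_not_dom D c h] at hi'
    exact hi' rfl

theorem odd_iff (c : Fin d → ℤ) (h : dom D c) : Odd (ph D c) ↔ lo D c ≠ c := by
  constructor
  · intro ho h'
    have := lo_x D c h
    rw [if_pos ho, h'] at this
    omega
  · intro h'
    by_contra ho
    apply h'
    funext i
    simp [lo, ho]

theorem period_zero (V : Fin d → ℤ)
    (hV : ∀ c : Fin d → ℤ, lo D (c + V) = lo D c + V ∧ hi D (c + V) = hi D c + V) : V = 0 := by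
  classical
  have hdom : ∀ c : Fin d → ℤ, dom D (c + V) ↔ dom D c := by
    intro c
    rw [dom_iff, dom_iff, (hV c).1, (hV c).2]
    refine exists_congr fun i => ?_
    simp only [Pi.add_apply, ne_eq]
    omega
  have hodd : ∀ c : Fin d → ℤ, dom D c → (Odd (ph D (c + V)) ↔ Odd (ph D c)) := by
    intro c hc
    rw [odd_iff D _ ((hdom c).2 hc), odd_iff D c hc, (hV c).1]
    simp
  have hVu : Even (V D.u) := by
    obtain ⟨c, hu, hw, hf, hc⟩ := exists_dom D 1 1 odd_one odd_one 0
    have := ((hdom c).2 hc).1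
    rw [Pi.add_apply, hu] at this
    rw [Int.odd_iff] at this
    rw [Int.even_iff]; omega
  have hw : ∀ n, Odd n → D.w (n + V D.u) = D.w n := by
    intro n hn
    by_contra hne
    obtain ⟨c, hu, hw, hf, hc⟩ := exists_dom D n 1 hn odd_one 0
    obtain ⟨c', hu', hw', hf', hc'⟩ := exists_dom D n 1 hn odd_one 1
    have h1 := ((hdom c).2 hc).2
    have h2 := ((hdom c').2 hc').2
    simp only [Pi.add_apply, hu, hu'] at h1 h2
    rw [hf _ (D.uw _).symm hne] at h1
    rw [hf' _ (D.uw _).symm hne] at h2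
    simp only [Pi.zero_apply, Pi.one_apply, Int.odd_iff] at h1 h2
    omega
  have hVw : ∀ n, Odd n → Even (V (D.w n)) := by
    intro n hn
    obtain ⟨c, hu, hw1, hf, hc⟩ := exists_dom D n 1 hn odd_one 0
    have h1 := ((hdom c).2 hc).2
    simp only [Pi.add_apply, hu, hw n hn, hw1] at h1
    rw [Int.odd_iff] at h1
    rw [Int.even_iff]; omega
  have hbit : ∀ n k k', Odd n → Odd k → Odd k' →
      Even (bit (n + V D.u) (k + V (D.w n)) - bit n k -
        (bit (n + V D.u) (k' + V (D.w n)) - bit n k')) := by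
    intro n k k' hn hk hk'
    obtain ⟨c, hu, hw1, hf, hc⟩ := exists_dom D n k hn hk 0
    obtain ⟨c', hu', hw1', hf', hc'⟩ := exists_dom D n k' hn hk' 0
    have h1 := hodd c hc
    have h2 := hodd c' hc'
    have hwn := hw n hn
    have a1 := D.wx (n + V D.u)
    have a2 := D.wy (n + V D.u)
    rw [hwn] at a1 a2
    simp only [ph, Pi.add_apply, hu, hu', hwn, hw1, hw1', hf _ (D.ux _).symm (D.wx n).symm,
      hf _ (D.uy _).symm (D.wy n).symm, hf _ (D.ux _).symm a1.symm, hf _ (D.uy _).symm a2.symm,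
      hf' _ (D.ux _).symm (D.wx n).symm,
      hf' _ (D.uy _).symm (D.wy n).symm, hf' _ (D.ux _).symm a1.symm,
      hf' _ (D.uy _).symm a2.symm, Pi.zero_apply, Int.odd_iff] at h1 h2
    rw [Int.even_iff]
    omega
  have hu0 : V D.u = 0 := by
    rw [Int.even_iff] at hVu
    rcases lt_trichotomy (V D.u) 0 with h | h | h
    · have hn : Odd (-V D.u - 1) := by rw [Int.odd_iff]; omega
      have h2 := hbit (-V D.u - 1) 1 (-1) hn (by decide) (by decide)
      have e : -V D.u - 1 + V D.u = -1 := by ring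
      have h3 : 1 ≤ -V D.u := by omega
      simp [e, bit, h3] at h2
    · exact h
    · have h1 := hVw (-1) (by decide)
      have h2 := hbit (-1) (1 - V (D.w (-1))) (-1 - V (D.w (-1))) (by decide)
        (by rw [Int.even_iff] at h1; rw [Int.odd_iff]; omega)
        (by rw [Int.even_iff] at h1; rw [Int.odd_iff]; omega)
      have h3 : 0 ≤ -1 + V D.u := by omega
      simp [bit, h3] at h2
  funext i
  by_cases hi' : i = D.u
  · rw [hi', hu0]; rfl
  obtain ⟨n, hn0, hn, hwn⟩ := D.surj i hi'
  have h1 := hVw n hn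
  have h2 := hbit n (-1) 1 hn (by decide) (by decide)
  rw [hwn] at h1 h2
  rw [hu0] at h2
  rw [Int.even_iff] at h1 h2
  simp only [bit, add_zero, hn0, true_and] at h2
  simp only [Pi.zero_apply]
  split_ifs at h2 <;> omega

/-- The unit cells around an integer point, indexed by sign vectors. -/
def cell (p s : Fin d → ℤ) : Fin d → ℤ := fun i => if s i = 1 then p i else p i - 1

def IsSign (s : Fin d → ℤ) : Prop := ∀ i, s i = 1 ∨ s i = -1

theorem corona_eq (p : Fin d → ℤ) :
    {P | P ∈ tiles D ∧ pt p ∈ P} = {P | ∃ s, IsSign s ∧ P = tile D (cell p s)} := by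
  ext P
  constructor
  · rintro ⟨⟨c, rfl⟩, hp⟩
    have hp' : ∀ i, lo D c i ≤ p i ∧ p i ≤ hi D c i := by
      intro i
      have := hp i
      simp only [pt_apply] at this
      exact_mod_cast this
    refine ⟨fun i => if p i < hi D c i then 1 else -1, fun i => ?_, ?_⟩
    · dsimp only; split_ifs <;> simp
    · symm
      apply tile_eq_of_cell_mem
      intro i
      have h1 := hp' i
      have h2 := lo_lt_hi D c i
      simp only [cell]
      split_ifs with h3 h4 h4
      · omega
      · simp at h4
      · norm_num at h4
      · omega
  · rintro ⟨s, hs, rfl⟩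
    refine ⟨⟨_, rfl⟩, fun i => ?_⟩
    have h1 := lo_le D (cell p s) i
    have h2 := lt_hi D (cell p s) i
    simp only [pt_apply]
    norm_cast
    have h3 : cell p s i = p i ∨ cell p s i = p i - 1 := by
      unfold cell; split_ifs <;> simp
    omega

theorem vertex_int {z : Ed d} (hz : IsVertex d (tiles D) z) : ∃ p : Fin d → ℤ, z = pt p := by
  obtain ⟨_, ⟨c, rfl⟩, hz⟩ := hz
  have := extreme_box _ _ hz
  have h2 : ∀ i, ∃ n : ℤ, z i = n := fun i => by
    rcases this i with h | h
    · exact ⟨_, h⟩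
    · exact ⟨_, h⟩
  choose p hp using h2
  exact ⟨p, by ext i; rw [hp i]; rfl⟩

/-- The standard corona: one tile for each sign vector. -/
def std (s : Fin d → ℤ) : Set (Ed d) :=
  {z | ∀ i, (if i = D.x 0 ∧ s D.u = 1 ∧ s (D.w 0) = 1 ∧ s (D.y 0) = -1 then (-1 : ℝ) else 0) ≤
      s i * z i ∧
    s i * z i ≤ (if i = D.x 0 ∧ s D.u = 1 ∧ s (D.w 0) = 1 ∧ s (D.y 0) = 1 then (2 : ℝ) else 1)}

/-- Signed permutations, followed by a translation. -/
def fmap (p τ : Fin d → ℤ) (π : Equiv.Perm (Fin d)) : Ed d ≃ᵃⁱ[ℝ] Ed d :=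
  ((LinearIsometryEquiv.piLpCongrLeft 2 ℝ ℝ π).trans
    (LinearIsometryEquiv.piLpCongrRight 2 fun i =>
      if τ i = 1 then LinearIsometryEquiv.refl ℝ ℝ
      else LinearIsometryEquiv.neg ℝ)).toAffineIsometryEquiv.trans
    (AffineIsometryEquiv.constVAdd ℝ _ (pt p))

theorem fmap_apply (p τ : Fin d → ℤ) (hτ : IsSign τ) (π : Equiv.Perm (Fin d)) (z : Ed d)
    (j : Fin d) : fmap p τ π z j = p j + τ j * z (π.symm j) := by
  rcases hτ j with h | h <;> simp [fmap, h, pt, Equiv.piCongrLeft'] 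

theorem exists_perm (n : ℤ) : ∃ π : Equiv.Perm (Fin d), π D.u = D.u ∧ π (D.w 0) = D.w n ∧
    π (D.x 0) = D.x n ∧ π (D.y 0) = D.y n := by
  classical
  let f : Fin d → Fin d := fun i => if i = D.u then D.u else if i = D.w 0 then D.w n else
    if i = D.x 0 then D.x n else D.y n
  have f1 : f D.u = D.u := by simp [f]
  have f2 : f (D.w 0) = D.w n := by simp [f, (D.uw 0).symm]
  have f3 : f (D.x 0) = D.x n := by simp [f, (D.ux 0).symm, (D.wx 0).symm]
  have f4 : f (D.y 0) = D.y n := by simp [f, (D.uy 0).symm, (D.wy 0).symm, (D.xy 0).symm]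
  let s : Finset (Fin d) := {D.u, D.w 0, D.x 0, D.y 0}
  obtain ⟨g, hg⟩ := Finset.exists_equiv_extend_of_card_eq (α := Fin d) (β := Fin d)
    (t := Finset.univ) (by simp) (s := s) (f := f) (by simp) (by
      intro a ha b hb hab
      have a1 := D.uw n
      have a2 := D.ux n
      have a3 := D.uy n
      have a4 := D.wx n
      have a5 := D.wy n
      have a6 := D.xy n
      simp only [s, Finset.coe_insert, Finset.coe_singleton, Set.mem_insert_iff,
        Set.mem_singleton_iff] at ha hb
      rcases ha with rfl | rfl | rfl | rfl <;> rcases hb with rfl | rfl | rfl | rfl <;>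
        first
        | rfl
        | (exfalso; simp only [f1, f2, f3, f4] at hab; grind))
  refine ⟨g.trans (Equiv.subtypeUnivEquiv (by simp)), ?_, ?_, ?_, ?_⟩
  · have := hg D.u (by simp [s]); simpa [f1] using this
  · have := hg (D.w 0) (by simp [s]); simpa [f2] using this
  · have := hg (D.x 0) (by simp [s]); simpa [f3] using this
  · have := hg (D.y 0) (by simp [s]); simpa [f4] using this

theorem unit_coord {p τ s : ℤ} (z : ℝ) (hτ : τ = 1 ∨ τ = -1) (hs : s = 1 ∨ s = -1) :
    ((((if τ * s = 1 then p else p - 1 : ℤ) : ℝ) ≤ p + τ * z ∧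
      p + τ * z ≤ (((if τ * s = 1 then p else p - 1) + 1 : ℤ) : ℝ)) ↔
      ((0 : ℝ) ≤ s * z ∧ s * z ≤ 1)) := by
  rcases hτ with rfl | rfl <;> rcases hs with rfl | rfl <;> norm_num <;>
    constructor <;> rintro ⟨h1, h2⟩ <;> constructor <;> linarith

theorem exists_frame (p : Fin d → ℤ) : ∃ (τ : Fin d → ℤ) (π : Equiv.Perm (Fin d)), IsSign τ ∧
    ∀ s, IsSign s → ∀ z, fmap p τ π z ∈ tile D (cell p (fun j => τ j * s (π.symm j))) ↔
      z ∈ std D s := by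
  classical
  obtain ⟨n, hn⟩ : ∃ n : ℤ, n = if Odd (p D.u) then p D.u else p D.u - 1 := ⟨_, rfl⟩
  obtain ⟨k, hk⟩ : ∃ k : ℤ, k = if Odd (p (D.w n)) then p (D.w n) else p (D.w n) - 1 := ⟨_, rfl⟩
  obtain ⟨π, h1, h2, h3, h4⟩ := exists_perm D n
  let τ : Fin d → ℤ := fun i => if i = D.u then (if Odd (p D.u) then 1 else -1) else
    if i = D.w n then (if Odd (p (D.w n)) then 1 else -1) else
    if i = D.y n then (if Even (p (D.x n) + p (D.y n) + bit n k) then 1 else -1) else 1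
  have t1 : τ D.u = if Odd (p D.u) then 1 else -1 := by simp [τ]
  have t2 : τ (D.w n) = if Odd (p (D.w n)) then 1 else -1 := by simp [τ, (D.uw n).symm]
  have t3 : τ (D.x n) = 1 := by simp [τ, (D.ux n).symm, (D.wx n).symm, D.xy n]
  have t4 : τ (D.y n) = if Even (p (D.x n) + p (D.y n) + bit n k) then 1 else -1 := by
    simp [τ, (D.uy n).symm, (D.wy n).symm]
  have hτ : IsSign τ := by
    intro i
    simp only [τ]
    split_ifs <;> simp
  clear_value τ
  refine ⟨τ, π, hτ, fun s hs z => ?_⟩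
  obtain ⟨c, hc⟩ : ∃ c, c = cell p (fun j => τ j * s (π.symm j)) := ⟨_, rfl⟩
  rw [← hc]
  have hcπ : ∀ i, c (π i) = if τ (π i) * s i = 1 then p (π i) else p (π i) - 1 := by
    intro i; simp [hc, cell]
  have cu : c D.u = if s D.u = 1 then n else (if Odd (p D.u) then p D.u - 1 else p D.u) := by
    have := hcπ D.u
    rw [h1, t1] at this
    rw [this, hn]
    rcases hs D.u with h | h <;> rw [h] <;> split_ifs <;> simp_all
  have cw : c (D.w n) = if s (D.w 0) = 1 then k else
      (if Odd (p (D.w n)) then p (D.w n) - 1 else p (D.w n)) := by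
    have := hcπ (D.w 0)
    rw [h2, t2] at this
    rw [this, hk]
    rcases hs (D.w 0) with h | h <;> rw [h] <;> split_ifs <;> simp_all
  have cx : c (D.x n) = if s (D.x 0) = 1 then p (D.x n) else p (D.x n) - 1 := by
    have := hcπ (D.x 0)
    rw [h3, t3] at this
    simpa using this
  have cy := hcπ (D.y 0)
  rw [h4, t4] at cy
  have hnodd : Odd n := by
    rw [hn]; split_ifs with h
    · exact h
    · rw [Int.odd_iff] at *; omega
  have hkodd : Odd k := by
    rw [hk]; split_ifs with h
    · exact h
    · rw [Int.odd_iff] at *; omega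
  have hdom : dom D c ↔ s D.u = 1 ∧ s (D.w 0) = 1 := by
    unfold dom
    by_cases hu : s D.u = 1
    · rw [if_pos hu] at cu
      rw [cu]
      by_cases hw : s (D.w 0) = 1
      · rw [if_pos hw] at cw
        simp [cw, hu, hw, hnodd, hkodd]
      · rw [if_neg hw] at cw
        have : ¬ Odd (c (D.w n)) := by
          rw [cw]; split_ifs with h
          · rw [Int.odd_iff] at *; omega
          · exact h
        simp [hw, this]
    · rw [if_neg hu] at cu
      have : ¬ Odd (c D.u) := by
        rw [cu]; split_ifs with h
        · rw [Int.odd_iff] at *; omega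
        · exact h
      simp [hu, this]
  have step : fmap p τ π z ∈ tile D c ↔ ∀ i, ((lo D c (π i) : ℤ) : ℝ) ≤
      p (π i) + τ (π i) * z i ∧ p (π i) + τ (π i) * z i ≤ ((hi D c (π i) : ℤ) : ℝ) := by
    constructor
    · intro h i
      have := h (π i)
      rw [fmap_apply p τ hτ] at this
      simpa using this
    · intro h j
      have := h (π.symm j)
      rw [fmap_apply p τ hτ]
      simpa using this
  rw [step]
  refine forall_congr' fun i => ?_
  by_cases hd : dom D c
  swap
  · rw [lo_not_dom D c hd, hi_not_dom D c hd]
    rw [hdom] at hd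
    rw [if_neg (by tauto), if_neg (by tauto), hcπ i]
    exact unit_coord (z i) (hτ _) (hs _)
  have hsu := hdom.1 hd
  rw [if_pos hsu.1] at cu
  by_cases hx : i = D.x 0
  swap
  · have : π i ≠ D.x (c D.u) := by
      rw [cu, ← h3]; exact fun h => hx (π.injective h)
    rw [lo_of_ne D c _ this, hi_of_ne D c _ this, if_neg (by tauto), if_neg (by tauto), hcπ i]
    exact unit_coord (z i) (hτ _) (hs _)
  subst hx
  have e1 := lo_x D c hd
  have e2 := hi_x D c hd
  rw [if_pos hsu.2] at cw
  rw [ph] at e1 e2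
  rw [cu, cw] at e1 e2
  rw [h3, e1, e2, t3, cx]
  simp only [hsu.1, hsu.2, true_and]
  have key : Odd ((if s (D.x 0) = 1 then p (D.x n) else p (D.x n) - 1) + c (D.y n) + bit n k) ↔
      s (D.x 0) * s (D.y 0) = -1 := by
    rw [cy]
    rcases hs (D.x 0) with h | h <;> rcases hs (D.y 0) with h' | h' <;> rw [h, h'] <;>
      by_cases hE : Even (p (D.x n) + p (D.y n) + bit n k) <;>
      simp only [hE, if_true, if_false] <;> norm_num <;>
      simp only [Int.odd_iff, Int.even_iff] at * <;> omega
  simp only [key]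
  generalize p (D.x n) = q
  generalize z (D.x 0) = t
  rcases hs (D.x 0) with h | h <;> rcases hs (D.y 0) with h' | h' <;> rw [h, h'] <;> norm_num <;>
    first
    | (constructor <;> rintro ⟨h1, h2⟩ <;> constructor <;> linarith)
    | (intro h1; constructor <;> intro h2 <;> linarith)

theorem fmap_zero (p τ : Fin d → ℤ) (hτ : IsSign τ) (π : Equiv.Perm (Fin d)) :
    fmap p τ π 0 = pt p := by
  ext j
  rw [fmap_apply p τ hτ]
  simp [pt]

theorem exists_map (p : Fin d → ℤ) : ∃ g : Ed d ≃ᵃⁱ[ℝ] Ed d, g 0 = pt p ∧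
    (fun P => g '' P) '' {P | ∃ s, IsSign s ∧ P = std D s} =
      {P | P ∈ tiles D ∧ pt p ∈ P} := by
  obtain ⟨τ, π, hτ, h⟩ := exists_frame D p
  refine ⟨fmap p τ π, fmap_zero p τ hτ π, ?_⟩
  have key : ∀ s, IsSign s →
      fmap p τ π '' std D s = tile D (cell p (fun j => τ j * s (π.symm j))) := by
    intro s hs
    ext y
    obtain ⟨z, rfl⟩ := (fmap p τ π).surjective y
    rw [(fmap p τ π).injective.mem_set_image, h s hs z]
  rw [corona_eq]
  ext P
  constructor
  · rintro ⟨_, ⟨s, hs, rfl⟩, rfl⟩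
    refine ⟨_, fun j => ?_, key s hs⟩
    rcases hτ j with h | h <;> rcases hs (π.symm j) with h' | h' <;> simp [h, h']
  · rintro ⟨s, hs, rfl⟩
    have hs' : IsSign (fun i => τ (π i) * s (π i)) := fun j => by
      rcases hτ (π j) with h | h <;> rcases hs (π j) with h' | h' <;> simp [h, h']
    refine ⟨_, ⟨_, hs', rfl⟩, ?_⟩
    dsimp only
    rw [key _ hs']
    congr 2
    funext j
    rcases hτ j with h | h <;> simp [h]

/-- The reflection of the `x`-axis. -/
def refl0 : Ed d ≃ₗᵢ[ℝ] Ed d :=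
  (Submodule.span ℝ {EuclideanSpace.single (D.x 0) (1 : ℝ)})ᗮ.reflection

theorem refl0_apply (z : Ed d) (i : Fin d) :
    refl0 D z i = if i = D.x 0 then - z i else z i := by
  rw [refl0, Submodule.reflection_orthogonal_apply, Submodule.reflection_singleton_apply]
  split_ifs with h
  · subst h
    simp [EuclideanSpace.inner_single_left]
    ring
  · simp [EuclideanSpace.inner_single_left, h]

theorem refl0_det : LinearMap.det (refl0 D).toLinearEquiv.toLinearMap = -1 := by
  have := Submodule.det_reflection
    (Submodule.span ℝ {EuclideanSpace.single (D.x 0) (1 : ℝ)})ᗮ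
  rw [refl0]
  rw [Submodule.orthogonal_orthogonal, finrank_span_singleton (by simp)] at this
  simpa using this

theorem refl0_std : (fun P => refl0 D '' P) '' {P | ∃ s, IsSign s ∧ P = std D s} =
    {P | ∃ s, IsSign s ∧ P = std D s} := by
  classical
  let r : (Fin d → ℤ) → (Fin d → ℤ) := fun s i => if i = D.x 0 then - s i else s i
  have hr : ∀ s, IsSign s → IsSign (r s) := by
    intro s hs i
    simp only [r]
    split_ifs
    · rcases hs i with h | h <;> simp [h]
    · exact hs i
  have hrr : ∀ s, r (r s) = s := by
    intro s; funext i; simp only [r]; split_ifs <;> simp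
  have key : ∀ s, refl0 D '' std D s = std D (r s) := by
    intro s
    ext y
    obtain ⟨z, rfl⟩ := (refl0 D).surjective y
    rw [(refl0 D).injective.mem_set_image]
    refine forall_congr' fun i => ?_
    have r1 : r s D.u = s D.u := by simp [r, D.ux 0]
    have r2 : r s (D.w 0) = s (D.w 0) := by simp [r, D.wx 0]
    have r3 : r s (D.y 0) = s (D.y 0) := by simp [r, (D.xy 0).symm]
    have r4 : (r s i : ℝ) * refl0 D z i = s i * z i := by
      rw [refl0_apply]; simp only [r]; split_ifs <;> simp
    rw [r1, r2, r3, r4]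
  ext P
  constructor
  · rintro ⟨_, ⟨s, hs, rfl⟩, rfl⟩
    exact ⟨_, hr s hs, key s⟩
  · rintro ⟨s, hs, rfl⟩
    exact ⟨_, ⟨_, hr s hs, rfl⟩, by dsimp only; rw [key, hrr]⟩

theorem det_isometry (f : Ed d ≃ₗᵢ[ℝ] Ed d) :
    LinearMap.det f.toLinearEquiv.toLinearMap = 1 ∨
      LinearMap.det f.toLinearEquiv.toLinearMap = -1 := by
  have h1 := LinearMap.normDet_eq_abs_det f.toLinearEquiv.toLinearMap
  have h2 := LinearIsometry.normDet_eq_one f.toLinearIsometry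
  have h3 : |LinearMap.det f.toLinearEquiv.toLinearMap| = 1 := by
    rw [← h1]; exact h2
  exact eq_or_eq_neg_of_abs_eq h3

theorem monocoronal : MonocoronalRM d (tiles D) := by
  intro a b ha hb
  obtain ⟨p, rfl⟩ := vertex_int D ha
  obtain ⟨q, rfl⟩ := vertex_int D hb
  obtain ⟨g, g0, hg⟩ := exists_map D p
  obtain ⟨h, h0, hh⟩ := exists_map D q
  have gs : g.symm (pt p) = 0 := by rw [← g0]; simp
  have key : ∀ r : Ed d ≃ₗᵢ[ℝ] Ed d,
      (fun P => r '' P) '' {P | ∃ s, IsSign s ∧ P = std D s} =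
        {P | ∃ s, IsSign s ∧ P = std D s} →
      (g.symm.trans (r.toAffineIsometryEquiv.trans h)) (pt p) = pt q ∧
      (fun P => (g.symm.trans (r.toAffineIsometryEquiv.trans h)) '' P) ''
        {P | P ∈ tiles D ∧ pt p ∈ P} = {P | P ∈ tiles D ∧ pt q ∈ P} := by
    intro r hr
    constructor
    · simp [gs, h0]
    · rw [← hg, ← hh]
      conv_rhs => rw [← hr]
      simp only [Set.image_image]
      refine Set.image_congr fun P _ => ?_
      simp
  rcases det_isometry (g.symm.trans h).linearIsometryEquiv with hd | hd
  · refine ⟨g.symm.trans ((LinearIsometryEquiv.refl ℝ (Ed d)).toAffineIsometryEquiv.trans h),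
      ?_, key _ (by simp)⟩
    exact hd
  · refine ⟨g.symm.trans ((refl0 D).toAffineIsometryEquiv.trans h), ?_, key _ (refl0_std D)⟩
    have e1 : ((g.symm.trans h).linearIsometryEquiv.toLinearEquiv : Ed d →ₗ[ℝ] Ed d) =
        (h.linearIsometryEquiv.toLinearEquiv : Ed d →ₗ[ℝ] Ed d) ∘ₗ
        (g.symm.linearIsometryEquiv.toLinearEquiv : Ed d →ₗ[ℝ] Ed d) := rfl
    have e2 : ((g.symm.trans ((refl0 D).toAffineIsometryEquiv.trans
        h)).linearIsometryEquiv.toLinearEquiv : Ed d →ₗ[ℝ] Ed d) =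
        (h.linearIsometryEquiv.toLinearEquiv : Ed d →ₗ[ℝ] Ed d) ∘ₗ
        ((refl0 D).toLinearEquiv.toLinearMap ∘ₗ
        (g.symm.linearIsometryEquiv.toLinearEquiv : Ed d →ₗ[ℝ] Ed d)) := rfl
    have hd' := hd
    rw [e1, LinearMap.det_comp] at hd'
    unfold OrientationPreserving
    rw [e2, LinearMap.det_comp, LinearMap.det_comp, refl0_det]
    linear_combination -hd'

end Construction

/-- For every `d ≥ 4` there is a non-face-to-face monocoronal (up to rigid motions)
tiling of `ℝ^d` that is non-periodic. -/
theorem exists_nonFaceToFace_monocoronalRM_nonperiodic (hd : 4 ≤ d) :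
    ∃ T : Set (Set (Ed d)), IsTiling d T ∧ ¬ FaceToFace d T ∧ MonocoronalRM d T ∧
      ∀ v : Ed d, v ∈ periodVectors d T → v = 0 := by
  obtain ⟨D⟩ := exists_axisData hd
  refine ⟨tiles D, isTiling_tiles D, not_faceToFace D, monocoronal D, fun v hv => ?_⟩
  obtain ⟨V, rfl, hV⟩ := period_int D hv
  rw [period_zero D V hV]
  ext i
  simp
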